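/- arXiv:1903.08280 — 3 statements merged into one kernel-verified Lean document; each statement's English description precedes it below -/
import Mathlib

section
/- The ambiguity A(R) is a 3-approximation of n·H(R); precisely, n·H(R) ≤ 3·A(R) and A(R) ≤ 2·n·H(R). -/
open scoped Classical

/-- The open interval family member `i` is `Set.Ioo (l i) (r i)`.
The contact set of `R_i` under the (identity) processing order:
indices `j ≤ i` whose interval intersects `R_i`. -/
noncomputable def contact (n : ℕ) (l r : Fin n → ℝ) (i : Fin n) : Finset (Fin n) :=
  Finset.univ.filter
    (fun j : Fin n => j ≤ i ∧ (Set.Ioo (l j) (r j) ∩ Set.Ioo (l i) (r i)).Nonempty)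

/-- The π-ambiguity of the family (already relabeled in processing order). -/
noncomputable def piAmbiguity (n : ℕ) (l r : Fin n → ℝ) : ℝ :=
  ∑ i : Fin n, Real.logb 2 ((contact n l r i).card : ℝ)

/-- A processing order (given as the relabeled family) is containment-compatible if
whenever `R_i ⊂ R_j` (proper subset) then `i < j`. -/
def ContainmentCompatible (n : ℕ) (l r : Fin n → ℝ) : Prop :=
  ∀ i j : Fin n, Set.Ioo (l i) (r i) ⊂ Set.Ioo (l j) (r j) → i < j

/-- The ambiguity: the minimum of the π-ambiguity over all processing orders. -/
noncomputable def ambiguity (n : ℕ) (l r : Fin n → ℝ) : ℝ :=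
  ⨅ π : Equiv.Perm (Fin n), piAmbiguity n (l ∘ π) (r ∘ π)

/-- Combinatorial equivalence of two indexed families of nonempty bounded open
intervals: `R_i` lies entirely to the left of `R_j` iff `I_i` lies entirely to
the left of `I_j`. -/
def CombEquiv {ι : Type*} (l r l' r' : ι → ℝ) : Prop :=
  ∀ i j : ι, (r i ≤ l j ↔ r' i ≤ l' j)

/-- `intervalE l r lam = E(R, λ)`: the supremum of `∑ log₂ |I_i|` over families of
open subintervals of `(0, λ)` combinatorially equivalent to `R`. -/
noncomputable def intervalE {ι : Type*} [Fintype ι] (l r : ι → ℝ) (lam : ℝ) : ℝ :=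
  sSup { x : ℝ | ∃ l' r' : ι → ℝ,
    (∀ i, 0 ≤ l' i ∧ l' i < r' i ∧ r' i ≤ lam) ∧
    CombEquiv l r l' r' ∧ x = ∑ i, Real.logb 2 (r' i - l' i) }

/-- The interval entropy `H(R) = E(R, n)/n`. -/
noncomputable def intervalEntropy (n : ℕ) (l r : Fin n → ℝ) : ℝ :=
  intervalE l r (n : ℝ) / (n : ℝ)

/-- The number of linear extensions of the interval order induced by `R`
(`i ≺ j` iff `r i ≤ l j`), counted via ranking permutations. -/
noncomputable def numLinExt (n : ℕ) (l r : Fin n → ℝ) : ℕ :=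
  Fintype.card {σ : Equiv.Perm (Fin n) // ∀ i j : Fin n, r i ≤ l j → σ i < σ j}

theorem mem_contact {n : ℕ} {l r : Fin n → ℝ} (h : ∀ i, l i < r i) {i j : Fin n} :
    j ∈ contact n l r i ↔ j ≤ i ∧ l j < r i ∧ l i < r j := by
  have hi := h i
  have hj := h j
  simp only [contact, Finset.mem_filter, Finset.mem_univ, true_and, Set.Ioo_inter_Ioo,
    Set.nonempty_Ioo, sup_lt_iff, lt_inf_iff]
  tauto

theorem self_mem_contact {n : ℕ} {l r : Fin n → ℝ} (h : ∀ i, l i < r i) (i : Fin n) :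
    i ∈ contact n l r i :=
  (mem_contact h).2 ⟨le_rfl, h i, h i⟩

theorem card_contact_pos {n : ℕ} {l r : Fin n → ℝ} (h : ∀ i, l i < r i) (i : Fin n) :
    0 < (contact n l r i).card :=
  Finset.card_pos.2 ⟨i, self_mem_contact h i⟩

/-- The piecewise linear map that contracts `[a, b]` by the factor `c`, fixes the half-line to
the left of `a` and translates the half-line to the right of `b`. -/
noncomputable def contraction (a b c t : ℝ) : ℝ :=
  t - (1 - c) * (max a (min t b) - a)

section contraction

variable {a b c s t : ℝ}

theorem contraction_of_le (hab : a ≤ b) (h : t ≤ a) : contraction a b c t = t := by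
  simp [contraction, min_eq_left (h.trans hab), h]

theorem contraction_of_ge (hab : a ≤ b) (h : b ≤ t) :
    contraction a b c t = t - (1 - c) * (b - a) := by
  simp [contraction, min_eq_right h, hab]

theorem mul_sub_le_contraction_sub (hc : c ≤ 1) (h : s ≤ t) :
    c * (t - s) ≤ contraction a b c t - contraction a b c s := by
  have key : max a (min t b) - max a (min s b) ≤ t - s := by
    rcases max_cases a (min t b) with h1 | h1 <;> rcases max_cases a (min s b) with h2 | h2 <;>
      rcases min_cases t b with h3 | h3 <;> rcases min_cases s b with h4 | h4 <;> linarith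
  have := mul_le_mul_of_nonneg_left key (sub_nonneg.2 hc)
  unfold contraction
  linarith

theorem contraction_mono (hc0 : 0 ≤ c) (hc : c ≤ 1) (h : s ≤ t) :
    contraction a b c s ≤ contraction a b c t := by
  have := mul_sub_le_contraction_sub (a := a) (b := b) hc h
  have := mul_nonneg hc0 (sub_nonneg.2 h)
  linarith

end contraction

/-- A contraction under which all intervals stay nonempty does not create contacts. -/
theorem card_contact_contraction_le {n : ℕ} {l r : Fin (n + 1) → ℝ} (h : ∀ i, l i < r i)
    {a b c : ℝ} (hc0 : 0 ≤ c) (hc : c ≤ 1)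
    (h' : ∀ i : Fin n, contraction a b c (l i.castSucc) < contraction a b c (r i.castSucc))
    (i : Fin n) :
    (contact n (fun i => contraction a b c (l i.castSucc))
      (fun i => contraction a b c (r i.castSucc)) i).card ≤
      (contact (n + 1) l r i.castSucc).card := by
  refine Finset.card_le_card_of_injOn Fin.castSucc (fun j hj => ?_)
    (Fin.castSucc_injective n).injOn
  have hj := (mem_contact h').1 hj
  refine (mem_contact h).2 ⟨by simpa using hj.1, ?_, ?_⟩
  · by_contra! hlt
    exact hj.2.1.not_ge (contraction_mono hc0 hc hlt)
  · by_contra! hlt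
    exact hj.2.2.not_ge (contraction_mono hc0 hc hlt)

theorem card_contact_last {n : ℕ} {l r : Fin (n + 1) → ℝ} (h : ∀ i, l i < r i) :
    (contact (n + 1) l r (Fin.last n)).card =
      (Finset.univ.filter fun i : Fin n =>
        l i.castSucc < r (Fin.last n) ∧ l (Fin.last n) < r i.castSucc).card + 1 := by
  have : contact (n + 1) l r (Fin.last n) = insert (Fin.last n)
      ((Finset.univ.filter fun i : Fin n =>
        l i.castSucc < r (Fin.last n) ∧ l (Fin.last n) < r i.castSucc).map Fin.castSuccEmb) := by
    ext j
    rw [mem_contact h]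
    induction j using Fin.lastCases with
    | last => simp [h]
    | cast j => simp [Fin.castSucc_ne_last, Fin.le_last]
  rw [this, Finset.card_insert_of_notMem (by simp [Fin.castSucc_ne_last]), Finset.card_map]

theorem add_div_pow_le_exp {n : ℕ} {u : ℝ} (h : 0 ≤ n + u) :
    (((n : ℝ) + u) / n) ^ n ≤ Real.exp u := by
  rcases n.eq_zero_or_pos with rfl | hn
  · simpa using h
  · have hn' : (0 : ℝ) < n := by exact_mod_cast hn
    calc (((n : ℝ) + u) / n) ^ n ≤ (Real.exp (u / n)) ^ n := by
          gcongr
          rw [add_div, div_self hn'.ne', add_comm]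
          exact Real.add_one_le_exp _
      _ = Real.exp u := by
          rw [← Real.exp_nat_mul]
          congr 1
          field_simp

theorem succ_pow_le_three_mul_pow (m : ℕ) : ((m : ℝ) + 1) ^ m ≤ 3 * (m : ℝ) ^ m := by
  rcases m.eq_zero_or_pos with rfl | hm
  · norm_num
  · have hm' : (0 : ℝ) < m := by exact_mod_cast hm
    have h1 : (((m : ℝ) + 1) / m) ^ m ≤ 3 :=
      (add_div_pow_le_exp (by positivity)).trans Real.exp_one_lt_three.le
    calc ((m : ℝ) + 1) ^ m = (((m : ℝ) + 1) / m) ^ m * (m : ℝ) ^ m := by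
          rw [← mul_pow, div_mul_cancel₀ _ hm'.ne']
      _ ≤ 3 * (m : ℝ) ^ m := by gcongr

/-- An interval of relative length `t` that meets `m` others can be contracted by a factor `c`
such that the gain in the remaining space makes up for the length lost. -/
theorem exists_contraction_factor (n m : ℕ) {t : ℝ} (ht : 0 < t) (htn : t ≤ n + 1) :
    ∃ c : ℝ, 0 ≤ c ∧ c ≤ 1 ∧ (m ≠ 0 → 0 < c) ∧
      t * ((n + 1 - (1 - c) * t) / n) ^ n ≤ ((m : ℝ) + 1) ^ 3 * c ^ m := by
  rcases le_total t m with h | h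
  · refine ⟨1, zero_le_one, le_rfl, fun _ => one_pos, ?_⟩
    have h1 := (add_div_pow_le_exp (n := n) (u := 1) (by positivity)).trans Real.exp_one_lt_three.le
    have h2 : t * (((n : ℝ) + 1) / n) ^ n ≤ m * 3 :=
      mul_le_mul h h1 (by positivity) (by positivity)
    have hm : (0 : ℝ) ≤ m := by positivity
    simp only [sub_self, zero_mul, sub_zero, one_pow, mul_one]
    nlinarith [pow_nonneg hm 3, sq_nonneg (m : ℝ)]
  · refine ⟨m / t, by positivity, (div_le_one ht).2 h, fun hm => by positivity, ?_⟩
    have hu : (n : ℝ) + 1 - (1 - m / t) * t = n + (m + 1 - t) := by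
      field_simp
      ring
    have hd : (0 : ℝ) < m + 1 := by positivity
    have h1 := add_div_pow_le_exp (n := n) (u := m + 1 - t) (by linarith [(Nat.cast_nonneg m : (0 : ℝ) ≤ m)])
    have h2 : (t / (m + 1)) ^ (m + 1) ≤ Real.exp (t - (m + 1)) := by
      calc (t / (m + 1)) ^ (m + 1) ≤ (Real.exp (t / (m + 1) - 1)) ^ (m + 1) := by
            gcongr
            linarith [Real.add_one_le_exp (t / ((m : ℝ) + 1) - 1)]
        _ = Real.exp (t - (m + 1)) := by
            rw [← Real.exp_nat_mul]
            congr 1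
            push_cast
            field_simp
    have h3 : t ^ (m + 1) * Real.exp (m + 1 - t) ≤ ((m : ℝ) + 1) ^ (m + 1) := by
      rw [div_pow, div_le_iff₀ (by positivity)] at h2
      calc t ^ (m + 1) * Real.exp (m + 1 - t)
          ≤ Real.exp (t - (m + 1)) * ((m : ℝ) + 1) ^ (m + 1) * Real.exp (m + 1 - t) := by gcongr
        _ = Real.exp (t - (m + 1) + (m + 1 - t)) * ((m : ℝ) + 1) ^ (m + 1) := by
            rw [Real.exp_add]
            ring
        _ = ((m : ℝ) + 1) ^ (m + 1) := by simp
    have h4 : ((m : ℝ) + 1) ^ (m + 1) ≤ ((m : ℝ) + 1) ^ 3 * (m : ℝ) ^ m := by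
      rcases m.eq_zero_or_pos with rfl | hm
      · norm_num
      · have hm' : (1 : ℝ) ≤ m := by exact_mod_cast hm
        calc ((m : ℝ) + 1) ^ (m + 1) = (m + 1) * ((m : ℝ) + 1) ^ m := by ring
          _ ≤ (m + 1) * (3 * (m : ℝ) ^ m) := by
              gcongr
              exact succ_pow_le_three_mul_pow m
          _ = 3 * (m + 1) * (m : ℝ) ^ m := by ring
          _ ≤ ((m : ℝ) + 1) ^ 3 * (m : ℝ) ^ m := by
              gcongr
              nlinarith [pow_pos hd 2]
    rw [hu, div_pow (m : ℝ) t, mul_div_assoc', le_div_iff₀ (by positivity)]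
    calc t * (((n : ℝ) + (m + 1 - t)) / n) ^ n * t ^ m
        ≤ t * Real.exp (m + 1 - t) * t ^ m := by gcongr
      _ = t ^ (m + 1) * Real.exp (m + 1 - t) := by ring
      _ ≤ _ := h3.trans h4

theorem prod_length_le (n : ℕ) {lam : ℝ} (hlam : 0 ≤ lam) (l r : Fin n → ℝ)
    (h : ∀ i, 0 ≤ l i ∧ l i < r i ∧ r i ≤ lam) :
    ∏ i, (r i - l i) ≤ (lam / n) ^ n * (∏ i, ((contact n l r i).card : ℝ)) ^ 3 := by
  induction n generalizing lam with
  | zero => simp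
  | succ n ih =>
    have hlr : ∀ i, l i < r i := fun i => (h i).2.1
    set a := l (Fin.last n) with ha
    set b := r (Fin.last n) with hb
    obtain ⟨ha0, hab, hbl⟩ := h (Fin.last n)
    set T := Finset.univ.filter fun i : Fin n => l i.castSucc < b ∧ a < r i.castSucc with hT
    have hcard : ((contact (n + 1) l r (Fin.last n)).card : ℝ) = T.card + 1 := by
      rw [card_contact_last hlr]
      push_cast
      rfl
    have hlam0 : 0 < lam := by linarith
    have hn0 : (0 : ℝ) < n + 1 := by positivity
    set s := lam / (n + 1) with hs
    have hs0 : 0 < s := by positivity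
    have hlams : lam = s * (n + 1) := by rw [hs]; field_simp
    obtain ⟨c, hc0, hc1, hcpos, hineq⟩ := exists_contraction_factor n T.card
      (t := (b - a) / s) (by have := sub_pos.2 hab; positivity)
      (by rw [div_le_iff₀ hs0]; linarith)
    have hcut : ∀ i ∉ T, contraction a b c (r (Fin.castSucc i)) -
        contraction a b c (l (Fin.castSucc i)) = r (Fin.castSucc i) - l (Fin.castSucc i) := by
      intro i hi
      have hi' : b ≤ l i.castSucc ∨ r i.castSucc ≤ a := by
        by_contra! hcon
        exact hi (by simp [hT, hcon])
      have hi1 := hlr i.castSucc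
      rcases hi' with hi' | hi'
      · rw [contraction_of_ge hab.le hi', contraction_of_ge hab.le (by linarith)]
        ring
      · rw [contraction_of_le hab.le hi', contraction_of_le hab.le (by linarith)]
    have hpos : ∀ i : Fin n,
        contraction a b c (l i.castSucc) < contraction a b c (r i.castSucc) := by
      intro i
      have hi1 := sub_pos.2 (hlr i.castSucc)
      by_cases hi : i ∈ T
      · have hc := hcpos (Finset.card_ne_zero_of_mem hi)
        have := mul_sub_le_contraction_sub (a := a) (b := b) hc1 (hlr i.castSucc).le
        have := mul_pos hc hi1
        linarith
      · have := hcut i hi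
        linarith
    have hlen : lam - (1 - c) * (b - a) = s * (n + 1 - (1 - c) * ((b - a) / s)) := by
      rw [hlams]
      field_simp
    have hlen0 : 0 ≤ lam - (1 - c) * (b - a) := by nlinarith
    have key := ih hlen0 (fun i => contraction a b c (l i.castSucc))
      (fun i => contraction a b c (r i.castSucc)) (fun i => ⟨?_, hpos i, ?_⟩)
    rotate_left
    · rw [← contraction_of_le (c := c) hab.le ha0]
      exact contraction_mono hc0 hc1 (h _).1
    · rw [← contraction_of_ge (c := c) hab.le hbl]
      exact contraction_mono hc0 hc1 (h _).2.2
    have hprod : c ^ T.card * ∏ i : Fin n, (r i.castSucc - l i.castSucc) ≤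
        ∏ i : Fin n, (contraction a b c (r i.castSucc) - contraction a b c (l i.castSucc)) := by
      have hT' : c ^ T.card = ∏ i : Fin n, if i ∈ T then c else 1 := by
        rw [Finset.prod_ite_mem, Finset.univ_inter, Finset.prod_const]
      rw [hT', ← Finset.prod_mul_distrib]
      refine Finset.prod_le_prod (fun i _ => ?_) (fun i _ => ?_)
      · have := sub_pos.2 (hlr i.castSucc)
        split_ifs <;> positivity
      · split_ifs with hi
        · exact mul_sub_le_contraction_sub hc1 (hlr _).le
        · rw [hcut i hi, one_mul]
    have hG : ∏ i : Fin n, ((contact n (fun i => contraction a b c (l i.castSucc))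
        (fun i => contraction a b c (r i.castSucc)) i).card : ℝ) ≤
        ∏ i : Fin n, ((contact (n + 1) l r i.castSucc).card : ℝ) :=
      Finset.prod_le_prod (fun _ _ => Nat.cast_nonneg _) fun i _ => by
        exact_mod_cast card_contact_contraction_le hlr hc0 hc1 hpos i
    rw [Fin.prod_univ_castSucc, Fin.prod_univ_castSucc, hcard]
    set G := ∏ i : Fin n, ((contact (n + 1) l r i.castSucc).card : ℝ)
    set P := ∏ i : Fin n, (r i.castSucc - l i.castSucc)
    have hG0 : 0 ≤ G := Finset.prod_nonneg fun _ _ => Nat.cast_nonneg _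
    have hcm : 0 < c ^ T.card := by
      rcases eq_or_ne T.card 0 with h0 | h0
      · simp [h0]
      · exact pow_pos (hcpos h0) _
    have hba := sub_pos.2 hab
    refine le_of_mul_le_mul_left ?_ hcm
    calc c ^ T.card * (P * (b - a)) = (c ^ T.card * P) * (b - a) := by ring
      _ ≤ (((lam - (1 - c) * (b - a)) / n) ^ n * G ^ 3) * (b - a) := by
          refine mul_le_mul_of_nonneg_right (hprod.trans (key.trans ?_)) hba.le
          have hG1 := Finset.prod_nonneg fun (i : Fin n) (_ : i ∈ Finset.univ) =>
            Nat.cast_nonneg (α := ℝ) (contact n (fun i => contraction a b c (l i.castSucc))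
              (fun i => contraction a b c (r i.castSucc)) i).card
          exact mul_le_mul_of_nonneg_left (pow_le_pow_left₀ hG1 hG 3)
            (pow_nonneg (div_nonneg hlen0 n.cast_nonneg) n)
      _ = s ^ (n + 1) * G ^ 3 * ((b - a) / s *
            ((n + 1 - (1 - c) * ((b - a) / s)) / n) ^ n) := by
          rw [hlen, mul_div_assoc, mul_pow, pow_succ]
          field_simp
          ring
      _ ≤ s ^ (n + 1) * G ^ 3 * (((T.card : ℝ) + 1) ^ 3 * c ^ T.card) :=
          mul_le_mul_of_nonneg_left hineq (mul_nonneg (by positivity) (pow_nonneg hG0 3))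
      _ = c ^ T.card * ((lam / ((n + 1 : ℕ) : ℝ)) ^ (n + 1) * (G * (T.card + 1)) ^ 3) := by
          push_cast
          rw [← hs]
          ring

theorem sum_logb_length_le {n : ℕ} (hn : n ≠ 0) (l r : Fin n → ℝ)
    (h : ∀ i, 0 ≤ l i ∧ l i < r i ∧ r i ≤ n) :
    ∑ i, Real.logb 2 (r i - l i) ≤ 3 * piAmbiguity n l r := by
  have hn' : (n : ℝ) ≠ 0 := by exact_mod_cast hn
  have hlen : ∀ i, 0 < r i - l i := fun i => sub_pos.2 (h i).2.1
  have hcard : ∀ i, (0 : ℝ) < (contact n l r i).card := fun i => by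
    exact_mod_cast card_contact_pos (fun i => (h i).2.1) i
  have key := prod_length_le n n.cast_nonneg l r h
  rw [div_self hn', one_pow, one_mul] at key
  rw [piAmbiguity, ← Real.logb_prod _ _ fun i _ => (hlen i).ne',
    ← Real.logb_prod _ _ fun i _ => (hcard i).ne']
  have := Real.logb_le_logb_of_le (b := 2) one_lt_two (Finset.prod_pos fun i _ => hlen i) key
  rwa [Real.logb_pow] at this

theorem CombEquiv.piAmbiguity_eq {n : ℕ} {l r l' r' : Fin n → ℝ} (h : CombEquiv l r l' r')
    (hlr : ∀ i, l i < r i) (hlr' : ∀ i, l' i < r' i) :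
    piAmbiguity n l' r' = piAmbiguity n l r := by
  unfold piAmbiguity
  refine Finset.sum_congr rfl fun i _ => ?_
  congr 3
  ext j
  rw [mem_contact hlr, mem_contact hlr', ← not_le, ← not_le, ← not_le, ← not_le, h i j, h j i]

/-- The average of the ranks of `t` among the left and among the right endpoints. -/
noncomputable def averageRank {n : ℕ} (l r : Fin n → ℝ) (t : ℝ) : ℝ :=
  (((Finset.univ.filter fun j => l j < t).card : ℝ) +
    (Finset.univ.filter fun j => r j ≤ t).card) / 2

theorem averageRank_nonneg {n : ℕ} (l r : Fin n → ℝ) (t : ℝ) : 0 ≤ averageRank l r t := by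
  unfold averageRank
  positivity

theorem averageRank_le {n : ℕ} (l r : Fin n → ℝ) (t : ℝ) : averageRank l r t ≤ n := by
  have h1 : ((Finset.univ.filter fun j => l j < t).card : ℝ) ≤ n := by
    exact_mod_cast (Finset.card_filter_le _ _).trans (by simp)
  have h2 : ((Finset.univ.filter fun j => r j ≤ t).card : ℝ) ≤ n := by
    exact_mod_cast (Finset.card_filter_le _ _).trans (by simp)
  unfold averageRank
  linarith

theorem averageRank_mono {n : ℕ} (l r : Fin n → ℝ) : Monotone (averageRank l r) := by
  intro s t hst
  unfold averageRank
  gcongr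

theorem averageRank_sub {n : ℕ} (l r : Fin n → ℝ) {s t : ℝ} (hst : s ≤ t) :
    averageRank l r t - averageRank l r s =
      (((Finset.univ.filter fun j => s ≤ l j ∧ l j < t).card : ℝ) +
        (Finset.univ.filter fun j => s < r j ∧ r j ≤ t).card) / 2 := by
  have h1 : (Finset.univ.filter fun j => l j < t).card =
      (Finset.univ.filter fun j => l j < s).card +
        (Finset.univ.filter fun j => s ≤ l j ∧ l j < t).card := by
    rw [← Finset.card_union_of_disjoint]
    · congr 1
      ext j
      simp
      grind
    · rw [Finset.disjoint_filter]
      grind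
  have h2 : (Finset.univ.filter fun j => r j ≤ t).card =
      (Finset.univ.filter fun j => r j ≤ s).card +
        (Finset.univ.filter fun j => s < r j ∧ r j ≤ t).card := by
    rw [← Finset.card_union_of_disjoint]
    · congr 1
      ext j
      simp
      grind
    · rw [Finset.disjoint_filter]
      grind
  unfold averageRank
  rw [h1, h2]
  push_cast
  ring

theorem averageRank_lt {n : ℕ} {l r : Fin n → ℝ} {i j : Fin n} (h : l j < r i) :
    averageRank l r (l j) < averageRank l r (r i) := by
  have h1 := averageRank_sub l r h.le
  have h2 : 0 < (Finset.univ.filter fun k => l j ≤ l k ∧ l k < r i).card :=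
    Finset.card_pos.2 ⟨j, by simpa using h⟩
  have h3 : (0 : ℝ) < (Finset.univ.filter fun k => l j ≤ l k ∧ l k < r i).card := by
    exact_mod_cast h2
  rw [← sub_pos, h1]
  positivity

theorem combEquiv_averageRank {n : ℕ} (l r : Fin n → ℝ) :
    CombEquiv l r (fun i => averageRank l r (l i)) (fun i => averageRank l r (r i)) := by
  refine fun i j => ⟨fun hij => averageRank_mono l r hij, fun hij => ?_⟩
  by_contra! hlt
  exact hij.not_gt (averageRank_lt hlt)

theorem card_contact_add_one_le {n : ℕ} {l r : Fin n → ℝ} (h : ∀ i, l i < r i)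
    (hmono : Monotone fun i => r i - l i) (i : Fin n) :
    ((contact n l r i).card : ℝ) + 1 ≤
      2 * (averageRank l r (r i) - averageRank l r (l i)) := by
  rw [averageRank_sub l r (h i).le, mul_div_cancel₀ _ two_ne_zero]
  norm_cast
  rw [← Finset.card_union_add_card_inter]
  refine add_le_add (Finset.card_le_card fun j hj => ?_) (Finset.card_pos.2 ⟨i, ?_⟩)
  · obtain ⟨hji, h1, h2⟩ := (mem_contact h).1 hj
    have h3 : r j - l j ≤ r i - l i := hmono hji
    simp only [Finset.mem_union, Finset.mem_filter, Finset.mem_univ, true_and]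
    rcases le_or_gt (l i) (l j) with h4 | h4
    · exact Or.inl ⟨h4, h1⟩
    · exact Or.inr ⟨h2, by linarith⟩
  · simpa using h i

theorem piAmbiguity_le_of_monotone_length {n : ℕ} {l r : Fin n → ℝ} (h : ∀ i, l i < r i)
    (hmono : Monotone fun i => r i - l i) :
    piAmbiguity n l r ≤ 2 * ∑ i, Real.logb 2 (averageRank l r (r i) - averageRank l r (l i)) := by
  rw [piAmbiguity, Finset.mul_sum]
  refine Finset.sum_le_sum fun i _ => ?_
  have h1 := card_contact_add_one_le h hmono i
  have h2 : (0 : ℝ) < (contact n l r i).card := by exact_mod_cast card_contact_pos h i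
  set x := averageRank l r (r i) - averageRank l r (l i)
  have h3 := Real.logb_pow 2 x 2
  push_cast at h3
  rw [← h3]
  exact Real.logb_le_logb_of_le one_lt_two h2 (by nlinarith [sq_nonneg (x - 1)])

theorem averageRank_comp_perm {n : ℕ} (l r : Fin n → ℝ) (π : Equiv.Perm (Fin n)) :
    averageRank (l ∘ π) (r ∘ π) = averageRank l r := by
  have key : ∀ p : Fin n → Prop,
      (Finset.univ.filter fun j => p (π j)).card = (Finset.univ.filter p).card := fun p =>
    Finset.card_equiv π (by simp)
  funext t
  simp only [averageRank, Function.comp_apply]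
  rw [key fun j => l j < t, key fun j => r j ≤ t]

theorem ambiguity_le (n : ℕ) (l r : Fin n → ℝ) (π : Equiv.Perm (Fin n)) :
    ambiguity n l r ≤ piAmbiguity n (l ∘ π) (r ∘ π) :=
  ciInf_le (Set.finite_range _).bddBelow π

theorem ambiguity_le_two_mul_sum {n : ℕ} {l r : Fin n → ℝ} (h : ∀ i, l i < r i) :
    ambiguity n l r ≤ 2 * ∑ i, Real.logb 2 (averageRank l r (r i) - averageRank l r (l i)) := by
  set π := Tuple.sort fun i => r i - l i
  have hmono : Monotone fun i => (r ∘ π) i - (l ∘ π) i := Tuple.monotone_sort fun i => r i - l i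
  have key := (ambiguity_le n l r π).trans
    (piAmbiguity_le_of_monotone_length (fun i => h (π i)) hmono)
  rw [averageRank_comp_perm] at key
  rwa [← Equiv.sum_comp π]

theorem sum_logb_length_le_ambiguity {n : ℕ} (hn : n ≠ 0) {l r l' r' : Fin n → ℝ}
    (hlr : ∀ i, l i < r i) (h : ∀ i, 0 ≤ l' i ∧ l' i < r' i ∧ r' i ≤ n)
    (he : CombEquiv l r l' r') :
    ∑ i, Real.logb 2 (r' i - l' i) ≤ 3 * ambiguity n l r := by
  obtain ⟨π, hπ⟩ := exists_eq_ciInf_of_finite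
    (f := fun π : Equiv.Perm (Fin n) => piAmbiguity n (l ∘ π) (r ∘ π))
  have key := sum_logb_length_le hn (l' ∘ π) (r' ∘ π) fun i => h (π i)
  have he' : CombEquiv (l ∘ π) (r ∘ π) (l' ∘ π) (r' ∘ π) := fun i j => he (π i) (π j)
  rw [he'.piAmbiguity_eq (fun i => hlr (π i)) (fun i => (h (π i)).2.1)] at key
  rw [ambiguity, ← hπ, ← Equiv.sum_comp π]
  exact key

theorem stmt1 (n : ℕ) (hn : 1 ≤ n) (l r : Fin n → ℝ) (hlr : ∀ i, l i < r i) :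
    (n : ℝ) * intervalEntropy n l r ≤ 3 * ambiguity n l r ∧
    ambiguity n l r ≤ 2 * (n : ℝ) * intervalEntropy n l r := by
  have hn0 : n ≠ 0 := by lia
  have hn' : (n : ℝ) ≠ 0 := by exact_mod_cast hn0
  have hE : (n : ℝ) * intervalEntropy n l r = intervalE l r n := mul_div_cancel₀ _ hn'
  rw [mul_assoc, hE]
  have hub : 3 * ambiguity n l r ∈ upperBounds { x : ℝ | ∃ l' r' : Fin n → ℝ,
      (∀ i, 0 ≤ l' i ∧ l' i < r' i ∧ r' i ≤ (n : ℝ)) ∧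
      CombEquiv l r l' r' ∧ x = ∑ i, Real.logb 2 (r' i - l' i) } := by
    rintro x ⟨l', r', h, he, rfl⟩
    exact sum_logb_length_le_ambiguity hn0 hlr h he
  have hmem : ∑ i, Real.logb 2 (averageRank l r (r i) - averageRank l r (l i)) ∈
      { x : ℝ | ∃ l' r' : Fin n → ℝ, (∀ i, 0 ≤ l' i ∧ l' i < r' i ∧ r' i ≤ (n : ℝ)) ∧
      CombEquiv l r l' r' ∧ x = ∑ i, Real.logb 2 (r' i - l' i) } :=
    ⟨_, _, fun i => ⟨averageRank_nonneg l r _, averageRank_lt (hlr i),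
      averageRank_le l r _⟩, combEquiv_averageRank l r, rfl⟩
  refine ⟨csSup_le ⟨_, hmem⟩ hub, (ambiguity_le_two_mul_sum hlr).trans ?_⟩
  have := le_csSup ⟨_, hub⟩ hmem
  unfold intervalE
  linarith
end

section
/- Suppose the index set {1,…,n} is partitioned into two nonempty sets A and B such that R_a ∩ R_b = ∅ for every a ∈ A and b ∈ B. Then E(R, n) = E(R_A, |A|) + E(R_B, |B|), where R_A and R_B denote the subfamilies of R indexed by A and B. (Equivalently, in an optimal embedding on the domain (0, n), the intervals indexed by A together occupy length |A| and those indexed by B together occupy length |B|.) -/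
open scoped Classical

open MeasureTheory

/-- The values `∑ log₂ |I_i|` over embeddings in `(0, lam)` are bounded above. -/
theorem bddAbove_embeddingValues {ι : Type*} [Fintype ι] (l r : ι → ℝ) (lam : ℝ) :
    BddAbove { x : ℝ | ∃ l' r' : ι → ℝ,
      (∀ i, 0 ≤ l' i ∧ l' i < r' i ∧ r' i ≤ lam) ∧
      CombEquiv l r l' r' ∧ x = ∑ i, Real.logb 2 (r' i - l' i) } := by
  refine ⟨∑ _i : ι, Real.logb 2 lam, ?_⟩
  rintro x ⟨l', r', h, -, rfl⟩
  refine Finset.sum_le_sum fun i _ => ?_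
  obtain ⟨h0, h1, h2⟩ := h i
  exact Real.logb_le_logb_of_le (by norm_num) (by linarith) (by linarith)

/-- Every family of intervals embeds in `(0, lam)`. -/
theorem nonempty_embeddingValues {ι : Type*} [Fintype ι] (l r : ι → ℝ) (hlr : ∀ i, l i < r i)
    {lam : ℝ} (hlam : 0 < lam) :
    { x : ℝ | ∃ l' r' : ι → ℝ,
      (∀ i, 0 ≤ l' i ∧ l' i < r' i ∧ r' i ≤ lam) ∧
      CombEquiv l r l' r' ∧ x = ∑ i, Real.logb 2 (r' i - l' i) }.Nonempty := by
  obtain ⟨m, hm⟩ := (Set.finite_range l).bddBelow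
  obtain ⟨M, hM⟩ := (Set.finite_range r).bddAbove
  have hm' : ∀ i, m ≤ l i := fun i => hm ⟨i, rfl⟩
  have hM' : ∀ i, r i ≤ M := fun i => hM ⟨i, rfl⟩
  have hd : 0 < |M - m| + 1 := by positivity
  have hc : 0 < lam / (|M - m| + 1) := by positivity
  refine ⟨_, fun i => (l i - m) * (lam / (|M - m| + 1)),
    fun i => (r i - m) * (lam / (|M - m| + 1)), fun i => ⟨?_, ?_, ?_⟩, fun i j => ?_, rfl⟩
  · exact mul_nonneg (by linarith [hm' i]) hc.le
  · exact mul_lt_mul_of_pos_right (by linarith [hlr i]) hc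
  · calc (r i - m) * (lam / (|M - m| + 1))
        ≤ (|M - m| + 1) * (lam / (|M - m| + 1)) :=
          mul_le_mul_of_nonneg_right (by linarith [hM' i, le_abs_self (M - m)]) hc.le
      _ = lam := by field_simp
  · rw [mul_le_mul_iff_left₀ hc, sub_le_sub_iff_right]

/-- Compressing an embedding to the union of its intervals and rescaling to total length
`card κ` costs at most the difference of the lengths (in natural-log units). -/
theorem sum_logb_le_intervalE_add {κ : Type*} [Fintype κ] [Nonempty κ] (l r l' r' : κ → ℝ)
    (h : ∀ i, l' i < r' i) (he : CombEquiv l r l' r') :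
    ∑ i, Real.logb 2 (r' i - l' i) ≤ intervalE l r (Fintype.card κ : ℝ) +
      (volume.real (⋃ i, Set.Ioo (l' i) (r' i)) - Fintype.card κ) / Real.log 2 := by
  set U := ⋃ i, Set.Ioo (l' i) (r' i) with hU
  have hfin : volume U ≠ ⊤ := by
    refine ((measure_iUnion_fintype_le _ _).trans_lt ?_).ne
    simp [ENNReal.sum_lt_top]
  have hfin' : ∀ s, volume (U ∩ s) ≠ ⊤ := fun s =>
    ne_top_of_le_ne_top hfin (measure_mono Set.inter_subset_left)
  set φ : ℝ → ℝ := fun x => volume.real (U ∩ Set.Iio x) with hφ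
  have hmono : Monotone φ := fun x y hxy =>
    measureReal_mono (Set.inter_subset_inter_right _ (Set.Iio_subset_Iio hxy)) (hfin' _)
  have hinc : ∀ i x, l' i ≤ x → x ≤ r' i → φ x + (r' i - x) ≤ φ (r' i) := by
    intro i x hx hxr
    have h1 : volume.real (Set.Ioo x (r' i)) = r' i - x := by
      rw [Real.volume_real_Ioo_of_le hxr]
    rw [← h1, hφ]
    simp only
    rw [← measureReal_union _ measurableSet_Ioo (hfin' _) (by simp)]
    · refine measureReal_mono ?_ (hfin' _)
      rintro y (⟨hy, hy'⟩ | hy)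
      · exact ⟨hy, lt_of_lt_of_le hy' hxr⟩
      · exact ⟨Set.mem_iUnion.2 ⟨i, lt_of_le_of_lt hx hy.1, hy.2⟩, hy.2⟩
    · rw [Set.disjoint_left]
      rintro y ⟨-, hy⟩ hy'
      exact absurd (Set.mem_Iio.1 hy) (not_lt.2 hy'.1.le)
  have hφ0 : ∀ x, 0 ≤ φ x := fun x => measureReal_nonneg
  have hφU : ∀ x, φ x ≤ volume.real U := fun x => measureReal_mono Set.inter_subset_left hfin
  set α := volume.real U with hα
  have hαpos : 0 < α := by
    obtain ⟨i⟩ := ‹Nonempty κ›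
    linarith [hinc i (l' i) le_rfl (h i).le, h i, hφ0 (l' i), hφU (r' i)]
  have hcard : (0 : ℝ) < Fintype.card κ := by exact_mod_cast Fintype.card_pos
  set N : ℝ := (Fintype.card κ : ℝ) with hN
  have hc : 0 < N / α := by positivity
  have hle : ∑ i, Real.logb 2 (φ (r' i) * (N / α) - φ (l' i) * (N / α)) ≤ intervalE l r N := by
    refine le_csSup (bddAbove_embeddingValues l r N)
      ⟨fun i => φ (l' i) * (N / α), fun i => φ (r' i) * (N / α), fun i => ⟨?_, ?_, ?_⟩,
        fun i j => ?_, rfl⟩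
    · exact mul_nonneg (hφ0 _) hc.le
    · exact mul_lt_mul_of_pos_right
        (by linarith [hinc i (l' i) le_rfl (h i).le, h i]) hc
    · calc φ (r' i) * (N / α) ≤ α * (N / α) := mul_le_mul_of_nonneg_right (hφU _) hc.le
        _ = N := by field_simp
    · rw [he i j, mul_le_mul_iff_left₀ hc]
      refine ⟨fun hij => hmono hij, fun hij => ?_⟩
      by_contra! hlt
      have h1 := hinc i (max (l' i) (l' j)) (le_max_left _ _) (max_le (h i).le hlt.le)
      have h2 := hmono (le_max_right (l' i) (l' j))
      have h3 : max (l' i) (l' j) < r' i := max_lt (h i) hlt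
      linarith
  have hsum : ∑ i, (Real.logb 2 (r' i - l' i) + Real.logb 2 (N / α)) ≤
      ∑ i, Real.logb 2 (φ (r' i) * (N / α) - φ (l' i) * (N / α)) := by
    refine Finset.sum_le_sum fun i _ => ?_
    have hpos : 0 < r' i - l' i := sub_pos.2 (h i)
    rw [← Real.logb_mul hpos.ne' hc.ne', ← sub_mul]
    exact Real.logb_le_logb_of_le (by norm_num) (mul_pos hpos hc)
      (mul_le_mul_of_nonneg_right (by linarith [hinc i (l' i) le_rfl (h i).le]) hc.le)
  rw [Finset.sum_add_distrib, Finset.sum_const, Finset.card_univ, nsmul_eq_mul, ← hN] at hsum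
  have hlog2 : 0 < Real.log 2 := Real.log_pos (by norm_num)
  have hkey : -(N * Real.logb 2 (N / α)) ≤ (α - N) / Real.log 2 := by
    have h1 : Real.log (α / N) ≤ α / N - 1 := Real.log_le_sub_one_of_pos (by positivity)
    have h2 : -(N * Real.logb 2 (N / α)) = N * Real.log (α / N) / Real.log 2 := by
      rw [← inv_div α N, Real.logb, Real.log_inv]
      ring
    rw [h2]
    refine div_le_div_of_nonneg_right ?_ hlog2.le
    calc N * Real.log (α / N) ≤ N * (α / N - 1) := mul_le_mul_of_nonneg_left h1 hcard.le
      _ = α - N := by field_simp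
  linarith

/-- The least nonnegative upper bound of `s` over the indices whose right endpoint is at
most a given point. -/
theorem exists_least_prefix_bound {κ : Type*} [Fintype κ] (r s : κ → ℝ) :
    ∃ o : ℝ → ℝ, (∀ x, 0 ≤ o x) ∧ (∀ x j, r j ≤ x → s j ≤ o x) ∧
      ∀ x t, 0 ≤ t → (∀ j, r j ≤ x → s j ≤ t) → o x ≤ t := by
  refine ⟨fun x => ((Finset.univ.filter fun j => r j ≤ x).sup fun j => (s j).toNNReal : NNReal),
    fun x => NNReal.coe_nonneg _, fun x j hj => ?_, fun x t ht hx => ?_⟩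
  · refine (Real.le_coe_toNNReal _).trans (NNReal.coe_le_coe.2 ?_)
    exact Finset.le_sup (f := fun j => (s j).toNNReal) (by simpa using hj)
  · rw [← Real.coe_toNNReal t ht]
    refine NNReal.coe_le_coe.2 (Finset.sup_le fun j hj => ?_)
    exact Real.toNNReal_le_toNNReal (hx j (by simpa using hj))

/-- Embeddings of two subfamilies with no intersections across can be interleaved. -/
theorem intervalE_add_le {ι : Type*} [Fintype ι] [DecidableEq ι] (l r : ι → ℝ) (hlr : ∀ i, l i < r i)
    (A : Finset ι) (hcomp : ∀ a ∈ A, ∀ b ∈ Aᶜ, r a ≤ l b ∨ r b ≤ l a)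
    {lam mu : ℝ} (hlam : 0 < lam) (hmu : 0 < mu) :
    intervalE (fun a : A => l a) (fun a : A => r a) lam +
      intervalE (fun b : (Aᶜ : Finset ι) => l b) (fun b : (Aᶜ : Finset ι) => r b) mu ≤
    intervalE l r (lam + mu) := by
  rw [← le_sub_iff_add_le]
  refine csSup_le (nonempty_embeddingValues (fun a : A => l a) (fun a : A => r a)
    (fun a => hlr a) hlam) ?_
  rintro x ⟨la, ra, ha, hea, rfl⟩
  rw [le_sub_comm]
  refine csSup_le (nonempty_embeddingValues (fun b : (Aᶜ : Finset ι) => l b)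
    (fun b : (Aᶜ : Finset ι) => r b) (fun b => hlr b) hmu) ?_
  rintro y ⟨lb, rb, hb, heb, rfl⟩
  rw [le_sub_iff_add_le]
  obtain ⟨oA, hA0, hAle, hAleast⟩ := exists_least_prefix_bound (fun a : A => r a) ra
  obtain ⟨oB, hB0, hBle, hBleast⟩ :=
    exists_least_prefix_bound (fun b : (Aᶜ : Finset ι) => r b) rb
  have hmonoA : Monotone oA := fun x y hxy =>
    hAleast x _ (hA0 y) fun j hj => hAle y j (le_trans hj hxy)
  have hmonoB : Monotone oB := fun x y hxy =>
    hBleast x _ (hB0 y) fun j hj => hBle y j (le_trans hj hxy)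
  have hAtop : ∀ x, oA x ≤ lam := fun x => hAleast x _ hlam.le fun j _ => (ha j).2.2
  have hBtop : ∀ x, oB x ≤ mu := fun x => hBleast x _ hmu.le fun j _ => (hb j).2.2
  have hBoff : ∀ a a' : A, l a' < r a → oB (l a') ≤ oB (l a) := fun a a' haa =>
    hBleast _ _ (hB0 _) fun b hba => hBle _ b <| by
      rcases hcomp a a.2 b b.2 with h | h
      · linarith [hlr b]
      · exact h
  have hAoff : ∀ b b' : (Aᶜ : Finset ι), l b' < r b → oA (l b') ≤ oA (l b) := fun b b' hbb =>
    hAleast _ _ (hA0 _) fun a hab => hAle _ a <| by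
      rcases hcomp a a.2 b b.2 with h | h
      · exact h
      · linarith [hlr a]
  have hcrossAB : ∀ (a : A) (b : (Aᶜ : Finset ι)), r a ≤ l b →
      ra a + oB (l a) ≤ lb b + oA (l b) := fun a b hab => by
    have h1 := hAle (l b) a hab
    have h2 : oB (l a) ≤ lb b := hBleast _ _ (hb b).1 fun b' hb' =>
      (heb b' b).1 (by linarith [hlr a])
    linarith
  have hcrossBA : ∀ (b : (Aᶜ : Finset ι)) (a : A), r b ≤ l a →
      rb b + oA (l b) ≤ la a + oB (l a) := fun b a hba => by
    have h1 := hBle (l a) b hba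
    have h2 : oA (l b) ≤ la a := hAleast _ _ (ha a).1 fun a' ha' =>
      (hea a' a).1 (by linarith [hlr b])
    linarith
  have hmem : ∀ i, i ∉ A → i ∈ Aᶜ := fun i hi => Finset.mem_compl.2 hi
  refine le_csSup (bddAbove_embeddingValues l r _)
    ⟨fun i => if hi : i ∈ A then la ⟨i, hi⟩ + oB (l i) else lb ⟨i, hmem i hi⟩ + oA (l i),
      fun i => if hi : i ∈ A then ra ⟨i, hi⟩ + oB (l i) else rb ⟨i, hmem i hi⟩ + oA (l i),
      fun i => ?_, fun i j => ?_, ?_⟩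
  · by_cases hi : i ∈ A
    · simp only [dif_pos hi]
      obtain ⟨h0, h1, h2⟩ := ha ⟨i, hi⟩
      exact ⟨by linarith [hB0 (l i)], by linarith, by linarith [hBtop (l i)]⟩
    · simp only [dif_neg hi]
      obtain ⟨h0, h1, h2⟩ := hb ⟨i, hmem i hi⟩
      exact ⟨by linarith [hA0 (l i)], by linarith, by linarith [hAtop (l i)]⟩
  · by_cases hi : i ∈ A <;> by_cases hj : j ∈ A
    · simp only [dif_pos hi, dif_pos hj]
      have h1 := hea ⟨i, hi⟩ ⟨j, hj⟩
      refine ⟨fun hij => ?_, fun hij => ?_⟩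
      · linarith [h1.1 hij, hmonoB ((hlr i).le.trans hij)]
      · by_contra! hlt
        have h2 := hBoff ⟨i, hi⟩ ⟨j, hj⟩ hlt
        have h3 := lt_of_not_ge (mt h1.2 (not_le.2 hlt))
        simp only at h2
        linarith
    · simp only [dif_pos hi, dif_neg hj]
      refine ⟨hcrossAB ⟨i, hi⟩ ⟨j, hmem j hj⟩, fun hij => ?_⟩
      refine (hcomp i hi j (hmem j hj)).resolve_right fun hji => ?_
      have := hcrossBA ⟨j, hmem j hj⟩ ⟨i, hi⟩ hji
      simp only at this
      linarith [(ha ⟨i, hi⟩).2.1, (hb ⟨j, hmem j hj⟩).2.1]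
    · simp only [dif_neg hi, dif_pos hj]
      refine ⟨hcrossBA ⟨i, hmem i hi⟩ ⟨j, hj⟩, fun hij => ?_⟩
      refine (hcomp j hj i (hmem i hi)).resolve_left fun hji => ?_
      have := hcrossAB ⟨j, hj⟩ ⟨i, hmem i hi⟩ hji
      simp only at this
      linarith [(ha ⟨j, hj⟩).2.1, (hb ⟨i, hmem i hi⟩).2.1]
    · simp only [dif_neg hi, dif_neg hj]
      have h1 := heb ⟨i, hmem i hi⟩ ⟨j, hmem j hj⟩
      refine ⟨fun hij => ?_, fun hij => ?_⟩
      · linarith [h1.1 hij, hmonoA ((hlr i).le.trans hij)]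
      · by_contra! hlt
        have h2 := hAoff ⟨i, hmem i hi⟩ ⟨j, hmem j hj⟩ hlt
        have h3 := lt_of_not_ge (mt h1.2 (not_le.2 hlt))
        simp only at h2
        linarith
  · rw [← Finset.sum_add_sum_compl A, ← Finset.sum_coe_sort A, ← Finset.sum_coe_sort Aᶜ, add_comm]
    congr 1
    · refine Finset.sum_congr rfl fun a _ => ?_
      simp
    · refine Finset.sum_congr rfl fun b _ => ?_
      simp only [dif_neg (Finset.mem_compl.1 b.2), add_sub_add_right_eq_sub]

theorem stmt4 (n : ℕ) (hn : 1 ≤ n) (l r : Fin n → ℝ) (hlr : ∀ i, l i < r i)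
    (A : Finset (Fin n)) (hA : A.Nonempty) (hB : Aᶜ.Nonempty)
    (hdisj : ∀ a ∈ A, ∀ b ∈ Aᶜ,
      Set.Ioo (l a) (r a) ∩ Set.Ioo (l b) (r b) = ∅) :
    intervalE l r (n : ℝ) =
      intervalE (fun a : A => l a) (fun a : A => r a) (A.card : ℝ) +
      intervalE (fun b : (Aᶜ : Finset (Fin n)) => l b)
        (fun b : (Aᶜ : Finset (Fin n)) => r b) (Aᶜ.card : ℝ) := by
  have hcomp : ∀ a ∈ A, ∀ b ∈ Aᶜ, r a ≤ l b ∨ r b ≤ l a := fun a ha b hb => by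
    have h := hdisj a ha b hb
    rw [Set.Ioo_inter_Ioo, Set.Ioo_eq_empty_iff] at h
    by_contra! hlt
    exact h (max_lt (lt_min (hlr a) hlt.2) (lt_min hlt.1 (hlr b)))
  have hApos : (0 : ℝ) < A.card := by exact_mod_cast hA.card_pos
  have hBpos : (0 : ℝ) < Aᶜ.card := by exact_mod_cast hB.card_pos
  have hcard : (A.card : ℝ) + Aᶜ.card = n := by
    exact_mod_cast (Finset.card_add_card_compl A).trans (Fintype.card_fin n)
  have : Nonempty A := hA.to_subtype
  have : Nonempty (Aᶜ : Finset (Fin n)) := hB.to_subtype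
  refine le_antisymm ?_ ?_
  · refine csSup_le (nonempty_embeddingValues l r hlr (Nat.cast_pos.2 hn)) ?_
    rintro x ⟨l', r', h, he, rfl⟩
    have h1 := sum_logb_le_intervalE_add (fun a : A => l a) (fun a : A => r a)
      (fun a : A => l' a) (fun a : A => r' a) (fun a => (h a).2.1) (fun a b => he a b)
    have h2 := sum_logb_le_intervalE_add (fun b : (Aᶜ : Finset (Fin n)) => l b)
      (fun b : (Aᶜ : Finset (Fin n)) => r b) (fun b : (Aᶜ : Finset (Fin n)) => l' b)
      (fun b : (Aᶜ : Finset (Fin n)) => r' b) (fun b => (h b).2.1) (fun a b => he a b)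
    rw [Fintype.card_coe] at h1 h2
    rw [Finset.sum_coe_sort A fun i => Real.logb 2 (r' i - l' i)] at h1
    rw [Finset.sum_coe_sort Aᶜ fun i => Real.logb 2 (r' i - l' i)] at h2
    rw [← Finset.sum_add_sum_compl A]
    set U := ⋃ a : A, Set.Ioo (l' a) (r' a) with hU
    set V := ⋃ b : (Aᶜ : Finset (Fin n)), Set.Ioo (l' b) (r' b) with hV
    have hsubU : U ⊆ Set.Ioo 0 (n : ℝ) := Set.iUnion_subset fun a =>
      Set.Ioo_subset_Ioo (h a).1 (h a).2.2
    have hsubV : V ⊆ Set.Ioo 0 (n : ℝ) := Set.iUnion_subset fun b =>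
      Set.Ioo_subset_Ioo (h b).1 (h b).2.2
    have hdisjUV : Disjoint U V := by
      rw [Set.disjoint_left]
      intro y hyU hyV
      obtain ⟨a, hya⟩ := Set.mem_iUnion.1 hyU
      obtain ⟨b, hyb⟩ := Set.mem_iUnion.1 hyV
      rcases hcomp a a.2 b b.2 with hab | hba
      · linarith [(he a b).1 hab, hya.2, hyb.1]
      · linarith [(he b a).1 hba, hyb.2, hya.1]
    have hfin : volume (Set.Ioo (0 : ℝ) n) ≠ ⊤ := by simp
    have hvol : volume.real U + volume.real V ≤ n := by
      rw [← measureReal_union hdisjUV (MeasurableSet.iUnion fun b => measurableSet_Ioo)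
        (ne_top_of_le_ne_top hfin (measure_mono hsubU))
        (ne_top_of_le_ne_top hfin (measure_mono hsubV))]
      refine (measureReal_mono (Set.union_subset hsubU hsubV) hfin).trans ?_
      simp
    have hlog2 : 0 < Real.log 2 := Real.log_pos (by norm_num)
    have h3 : (volume.real U - A.card) / Real.log 2 + (volume.real V - Aᶜ.card) / Real.log 2
        ≤ 0 := by
      rw [← add_div]
      exact div_nonpos_of_nonpos_of_nonneg (by linarith) hlog2.le
    linarith
  · rw [← hcard]
    exact intervalE_add_le l r hlr A hcomp hApos hBpos
end

section
/- For any containment-compatible processing order π of the family R, there exists a family (I_1, …, I_n) of open subintervals of (0, n), combinatorially equivalent to R, such that for every i the length of I_i is at least (|Γ_i| + 1)/2. -/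
open scoped Classical

open Finset in
/-- If no interval preceding `R_i` properly contains it, each member of the contact set has its left
or its right endpoint inside `R_i`, and `R_i` itself has both. -/
theorem card_contact_add_one_le_s8 (n : ℕ) (l r : Fin n → ℝ) (hlr : ∀ i, l i < r i)
    (hcc : ContainmentCompatible n l r) (i : Fin n) :
    #(contact n l r i) + 1 ≤
      #{j | l i ≤ l j ∧ l j < r i} + #{j | l i < r j ∧ r j ≤ r i} := by
  rw [← card_union_add_card_inter]
  refine add_le_add (card_le_card fun j hj => ?_) (card_pos.2 ⟨i, ?_⟩)
  · simp only [contact, mem_filter, mem_univ, true_and] at hj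
    obtain ⟨hji, x, ⟨h1, h2⟩, h3, h4⟩ := hj
    simp only [mem_union, mem_filter, mem_univ, true_and]
    by_contra! h
    have hl : l j < l i := by
      by_contra! hl
      linarith [h.1 hl]
    have hr : r i < r j := h.2 (h3.trans h2)
    refine (hcc i j ⟨Set.Ioo_subset_Ioo hl.le hr.le, fun hs => ?_⟩).not_ge hji
    have := (Set.Ioo_subset_Ioo_iff (hlr j)).1 hs
    linarith [this.1]
  · simp [hlr i]

open Finset in
theorem card_filter_eq_add_of_iff_or {ι : Type*} [Fintype ι] (p q s : ι → Prop)
    [DecidablePred p] [DecidablePred q] [DecidablePred s]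
    (hps : ∀ j, s j ↔ p j ∨ q j) (hd : ∀ j, p j → ¬ q j) :
    #{j | s j} = #{j | p j} + #{j | q j} := by
  rw [← card_union_of_disjoint (disjoint_filter.2 fun j _ => hd j), ← filter_or]
  simp only [hps]

open Finset in
theorem exists_combEquiv_of_containmentCompatible (n : ℕ) (l r : Fin n → ℝ)
    (hlr : ∀ i, l i < r i) (hcc : ContainmentCompatible n l r) :
    ∃ l' r' : Fin n → ℝ,
      (∀ i, 0 ≤ l' i ∧ l' i < r' i ∧ r' i ≤ (n : ℝ)) ∧ CombEquiv l r l' r' ∧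
      ∀ i, ((#(contact n l r i) : ℝ) + 1) / 2 ≤ r' i - l' i := by
  let c (x : ℝ) : ℕ := #{j | l j < x} + #{j | r j ≤ x}
  have hmono : Monotone c := fun x y hxy => add_le_add
    (card_le_card <| monotone_filter_right _ fun j _ hj => lt_of_lt_of_le hj hxy)
    (card_le_card <| monotone_filter_right _ fun j _ hj => le_trans hj hxy)
  have hstrict (j : Fin n) {x : ℝ} (hx : l j < x) : c (l j) < c x :=
    add_lt_add_of_lt_of_le
      (card_lt_card <| ssubset_iff_of_subset
        (monotone_filter_right _ fun k _ hk => lt_trans hk hx) |>.2 ⟨j, by simp [hx]⟩)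
      (card_le_card <| monotone_filter_right _ fun k _ hk => le_trans hk hx.le)
  have hle (x : ℝ) : c x ≤ n + n := by
    simpa using add_le_add (card_le_univ (univ.filter fun j => l j < x))
      (card_le_univ (univ.filter fun j => r j ≤ x))
  have hlen (i : Fin n) : c (l i) + (#(contact n l r i) + 1) ≤ c (r i) := by
    have h := card_contact_add_one_le_s8 n l r hlr hcc i
    have h1 := card_filter_eq_add_of_iff_or (fun j => l j < l i) (fun j => l i ≤ l j ∧ l j < r i)
      (fun j => l j < r i) (by grind) (by grind)
    have h2 := card_filter_eq_add_of_iff_or (fun j => r j ≤ l i) (fun j => l i < r j ∧ r j ≤ r i)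
      (fun j => r j ≤ r i) (by grind) (by grind)
    simp only [c]
    omega
  refine ⟨fun i => c (l i) / 2, fun i => c (r i) / 2, fun i => ⟨by positivity, ?_, ?_⟩,
    fun i j => ⟨fun h => ?_, fun h => ?_⟩, fun i => ?_⟩
  · have : (c (l i) : ℝ) < c (r i) := mod_cast hstrict i (hlr i)
    linarith
  · have : (c (r i) : ℝ) ≤ n + n := mod_cast hle (r i)
    linarith
  · have : (c (r i) : ℝ) ≤ c (l j) := mod_cast hmono h
    linarith
  · by_contra! hij
    have : (c (l j) : ℝ) < c (r i) := mod_cast hstrict j hij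
    linarith
  · have : (c (l i) : ℝ) + (#(contact n l r i) + 1) ≤ c (r i) := mod_cast hlen i
    linarith

theorem stmt8 (n : ℕ) (hn : 1 ≤ n) (l r : Fin n → ℝ) (hlr : ∀ i, l i < r i)
    (π : Equiv.Perm (Fin n))
    (hcc : ContainmentCompatible n (l ∘ π) (r ∘ π)) :
    ∃ l' r' : Fin n → ℝ,
      (∀ i, 0 ≤ l' i ∧ l' i < r' i ∧ r' i ≤ (n : ℝ)) ∧
      CombEquiv (l ∘ π) (r ∘ π) l' r' ∧
      ∀ i : Fin n,
        (((contact n (l ∘ π) (r ∘ π) i).card : ℝ) + 1) / 2 ≤ r' i - l' i := by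
  exact exists_combEquiv_of_containmentCompatible n (l ∘ π) (r ∘ π) (fun i => hlr (π i)) hcc
end
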